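/- Let R be a countable ring and let D denote the class of all flat Mittag-Leffler right R-modules. Then D is a precovering class in the category of right R-modules if and only if R is right perfect (equivalently, every flat right R-module is projective). -/

import Mathlib

/-! Tensor product of a right `R`-module with a left `R`-module over a
(possibly noncommutative) ring `R`, Mittag-Leffler modules, flat right modules. -/

universe u

open scoped TensorProduct DirectSum

section NCTensor

variable (R : Type u) [Ring R] (M : Type u) [AddCommGroup M] [Module Rᵐᵒᵖ M]

/-- The subgroup of balancing relations in `M ⊗_ℤ Q`, where `M` is a right `R`-module
and `Q` is a left `R`-module. -/
noncomputable def balancedSub (Q : Type u) [AddCommGroup Q] [Module R Q] :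
    AddSubgroup (TensorProduct ℤ M Q) :=
  AddSubgroup.closure
    {x | ∃ (m : M) (r : R) (q : Q),
      x = (MulOpposite.op r • m) ⊗ₜ[ℤ] q - m ⊗ₜ[ℤ] (r • q)}

/-- The tensor product `M ⊗_R Q` of a right `R`-module `M` and a left `R`-module `Q`. -/
def NCTensor (Q : Type u) [AddCommGroup Q] [Module R Q] : Type u :=
  TensorProduct ℤ M Q ⧸ balancedSub R M Q

noncomputable instance (Q : Type u) [AddCommGroup Q] [Module R Q] : AddCommGroup (NCTensor R M Q) :=
  inferInstanceAs (AddCommGroup (TensorProduct ℤ M Q ⧸ balancedSub R M Q))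

/-- The canonical projection onto the tensor product `M ⊗_R Q`. -/
noncomputable def NCTensor.mk (Q : Type u) [AddCommGroup Q] [Module R Q] :
    TensorProduct ℤ M Q →+ NCTensor R M Q :=
  QuotientAddGroup.mk' (balancedSub R M Q)

variable {R M} in
/-- The map `M ⊗_R Q →+ M ⊗_R Q'` induced by a map of left `R`-modules `f : Q → Q'`. -/
noncomputable def NCTensor.map {Q Q' : Type u} [AddCommGroup Q] [Module R Q]
    [AddCommGroup Q'] [Module R Q'] (f : Q →ₗ[R] Q') :
    NCTensor R M Q →+ NCTensor R M Q' :=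
  QuotientAddGroup.lift (balancedSub R M Q)
    ((NCTensor.mk R M Q').comp
      (LinearMap.lTensor M f.toAddMonoidHom.toIntLinearMap).toAddMonoidHom)
    (by
      set φ := (NCTensor.mk R M Q').comp
        (LinearMap.lTensor M f.toAddMonoidHom.toIntLinearMap).toAddMonoidHom with hφ
      intro x hx
      have hle : balancedSub R M Q ≤ φ.ker := by
        rw [balancedSub]
        rw [AddSubgroup.closure_le]
        rintro _ ⟨m, r, q, rfl⟩
        have h1 : φ ((MulOpposite.op r • m) ⊗ₜ[ℤ] q - m ⊗ₜ[ℤ] (r • q)) =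
            NCTensor.mk R M Q'
              ((MulOpposite.op r • m) ⊗ₜ[ℤ] (f q) - m ⊗ₜ[ℤ] (r • f q)) := by
          simp [hφ, LinearMap.lTensor_tmul, map_sub]
        simp only [SetLike.mem_coe, AddMonoidHom.mem_ker, h1]
        exact (QuotientAddGroup.eq_zero_iff _).2
          (AddSubgroup.subset_closure ⟨m, r, f q, rfl⟩)
      exact hle hx)

variable {ι : Type u} (Q : ι → Type u) [∀ i, AddCommGroup (Q i)] [∀ i, Module R (Q i)]

/-- Auxiliary map for the Mittag-Leffler comparison map. -/
noncomputable def piCompareAux :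
    TensorProduct ℤ M (∀ i, Q i) →+ ∀ i, NCTensor R M (Q i) where
  toFun x i := NCTensor.mk R M (Q i)
    (LinearMap.lTensor M (LinearMap.proj (R := ℤ) (φ := Q) i) x)
  map_zero' := by funext i; simp
  map_add' x y := by funext i; simp [map_add]

/-- The canonical comparison map `M ⊗_R (∏ i, Q i) →+ ∏ i, (M ⊗_R Q i)`. -/
noncomputable def mlCompare : NCTensor R M (∀ i, Q i) →+ ∀ i, NCTensor R M (Q i) :=
  QuotientAddGroup.lift (balancedSub R M (∀ i, Q i)) (piCompareAux R M Q)
    (by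
      intro x hx
      have hle : balancedSub R M (∀ i, Q i) ≤ (piCompareAux R M Q).ker := by
        rw [balancedSub, AddSubgroup.closure_le]
        rintro _ ⟨m, r, q, rfl⟩
        simp only [SetLike.mem_coe, AddMonoidHom.mem_ker]
        funext i
        have h1 : piCompareAux R M Q
            ((MulOpposite.op r • m) ⊗ₜ[ℤ] q - m ⊗ₜ[ℤ] (r • q)) i =
            NCTensor.mk R M (Q i)
              ((MulOpposite.op r • m) ⊗ₜ[ℤ] (q i) - m ⊗ₜ[ℤ] (r • q i)) := by
          simp [piCompareAux, map_sub, LinearMap.lTensor_tmul]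
        rw [Pi.zero_apply, h1]
        exact (QuotientAddGroup.eq_zero_iff _).2
          (AddSubgroup.subset_closure ⟨m, r, q i, rfl⟩)
      exact hle hx)

/-- A right `R`-module `M` is Mittag-Leffler if for every family `(Q i)` of left
`R`-modules the canonical map `M ⊗_R ∏ Q i → ∏ (M ⊗_R Q i)` is injective. -/
def IsMittagLeffler : Prop :=
  ∀ (ι : Type u) (Q : ι → Type u) [∀ i, AddCommGroup (Q i)] [∀ i, Module R (Q i)],
    Function.Injective (mlCompare R M Q)

/-- A right `R`-module `M` is flat if tensoring with `M` preserves injectivity of maps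
of left `R`-modules. -/
def IsRightFlat : Prop :=
  ∀ (Q Q' : Type u) [AddCommGroup Q] [AddCommGroup Q'] [Module R Q] [Module R Q']
    (f : Q →ₗ[R] Q'), Function.Injective f →
      Function.Injective (NCTensor.map (M := M) f)

end NCTensor

section TensorLemmas

variable {R : Type u} [Ring R] {M : Type u} [AddCommGroup M] [Module Rᵐᵒᵖ M]

/-- Balanced biadditive maps factor through the tensor product. -/
noncomputable def NCTensor.lift {Q : Type u} [AddCommGroup Q] [Module R Q]
    {G : Type*} [AddCommGroup G] (b : M →+ Q →+ G)
    (hb : ∀ (m : M) (r : R) (q : Q), b (MulOpposite.op r • m) q = b m (r • q)) :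
    NCTensor R M Q →+ G :=
  QuotientAddGroup.lift (balancedSub R M Q)
    (TensorProduct.liftAddHom b fun r m q => by simp)
    (by
      have hle : balancedSub R M Q ≤
          (TensorProduct.liftAddHom b fun (r : ℤ) m q => by simp).ker := by
        rw [balancedSub, AddSubgroup.closure_le]
        rintro _ ⟨m, r, q, rfl⟩
        simp [AddMonoidHom.mem_ker, hb]
      exact hle)

@[simp]
theorem NCTensor.lift_mk_tmul {Q : Type u} [AddCommGroup Q] [Module R Q]
    {G : Type*} [AddCommGroup G] (b : M →+ Q →+ G)
    (hb : ∀ (m : M) (r : R) (q : Q), b (MulOpposite.op r • m) q = b m (r • q)) (m : M) (q : Q) :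
    NCTensor.lift b hb (NCTensor.mk R M Q (m ⊗ₜ q)) = b m q := rfl

@[simp]
theorem NCTensor.map_mk_tmul {Q Q' : Type u} [AddCommGroup Q] [Module R Q]
    [AddCommGroup Q'] [Module R Q'] (f : Q →ₗ[R] Q') (m : M) (q : Q) :
    NCTensor.map f (NCTensor.mk R M Q (m ⊗ₜ q)) = NCTensor.mk R M Q' (m ⊗ₜ f q) := rfl

@[simp]
theorem mlCompare_mk_tmul {ι : Type u} (Q : ι → Type u) [∀ i, AddCommGroup (Q i)]
    [∀ i, Module R (Q i)] (m : M) (q : ∀ i, Q i) (i : ι) :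
    mlCompare R M Q (NCTensor.mk R M _ (m ⊗ₜ q)) i = NCTensor.mk R M (Q i) (m ⊗ₜ q i) := rfl

theorem NCTensor.op_smul_tmul {Q : Type u} [AddCommGroup Q] [Module R Q] (m : M) (r : R) (q : Q) :
    NCTensor.mk R M Q ((MulOpposite.op r • m) ⊗ₜ q) = NCTensor.mk R M Q (m ⊗ₜ (r • q)) := by
  rw [← sub_eq_zero, ← map_sub]
  exact (QuotientAddGroup.eq_zero_iff _).2 (AddSubgroup.subset_closure ⟨m, r, q, rfl⟩)

theorem NCTensor.induction_on {Q : Type u} [AddCommGroup Q] [Module R Q]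
    {P : NCTensor R M Q → Prop} (z : NCTensor R M Q) (zero : P 0)
    (tmul : ∀ m q, P (NCTensor.mk R M Q (m ⊗ₜ q))) (add : ∀ x y, P x → P y → P (x + y)) : P z := by
  obtain ⟨t, rfl⟩ := QuotientAddGroup.mk'_surjective (balancedSub R M Q) z
  change P (NCTensor.mk R M Q t)
  induction t with
  | zero => simpa using zero
  | tmul m q => exact tmul m q
  | add x y hx hy => rw [map_add]; exact add _ _ hx hy

/-- The product of a coordinate vector over `Rᵐᵒᵖ` with an element of a left `R`-module. -/
noncomputable def finsuppDot (ι : Type*) (Q : Type*) [AddCommGroup Q] [Module R Q] :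
    (ι →₀ Rᵐᵒᵖ) →+ Q →+ (ι →₀ Q) :=
  AddMonoidHom.mk' (fun f => AddMonoidHom.mk'
    (fun q => f.mapRange (fun r => r.unop • q) (by simp)) fun a b => by ext; simp)
    fun a b => by ext; simp [add_smul]

@[simp]
theorem finsuppDot_apply {ι : Type*} {Q : Type*} [AddCommGroup Q] [Module R Q]
    (f : ι →₀ Rᵐᵒᵖ) (q : Q) (i : ι) : finsuppDot ι Q f q i = (f i).unop • q := rfl

theorem finsuppDot_op_smul {ι : Type*} {Q : Type*} [AddCommGroup Q] [Module R Q]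
    (f : ι →₀ Rᵐᵒᵖ) (r : R) (q : Q) :
    finsuppDot ι Q (MulOpposite.op r • f) q = finsuppDot ι Q f (r • q) := by
  ext; simp [mul_smul]

/-- Every finite set of elements of `M` is fixed by an endomorphism which factors through
a free module. -/
def IsLocallyProjective (S : Type u) [Ring S] (M : Type u) [AddCommGroup M] [Module S M] : Prop :=
  ∀ C : Finset M, ∃ (ι : Type u) (α : M →ₗ[S] (ι →₀ S)) (β : (ι →₀ S) →ₗ[S] M),
    ∀ x ∈ C, β (α x) = x

/-- The map `M ⊗ Q → Q^(ι)` induced by a map from `M` to a free module. -/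
noncomputable def NCTensor.toFinsupp {ι : Type*} (α : M →ₗ[Rᵐᵒᵖ] (ι →₀ Rᵐᵒᵖ))
    (Q : Type u) [AddCommGroup Q] [Module R Q] : NCTensor R M Q →+ (ι →₀ Q) :=
  NCTensor.lift ((finsuppDot ι Q).comp α.toAddMonoidHom) fun m r q => by
    simp [finsuppDot_op_smul]

@[simp]
theorem NCTensor.toFinsupp_mk_tmul {ι : Type*} (α : M →ₗ[Rᵐᵒᵖ] (ι →₀ Rᵐᵒᵖ))
    (Q : Type u) [AddCommGroup Q] [Module R Q] (m : M) (q : Q) :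
    NCTensor.toFinsupp α Q (NCTensor.mk R M Q (m ⊗ₜ q)) = finsuppDot ι Q (α m) q := rfl

/-- The map `Q^(ι) → M ⊗ Q` induced by a map from a free module to `M`. -/
noncomputable def NCTensor.ofFinsupp {ι : Type*} (β : (ι →₀ Rᵐᵒᵖ) →ₗ[Rᵐᵒᵖ] M)
    (Q : Type u) [AddCommGroup Q] [Module R Q] : (ι →₀ Q) →+ NCTensor R M Q :=
  Finsupp.liftAddHom fun i => (NCTensor.mk R M Q).comp
    (TensorProduct.mk ℤ M Q (β (Finsupp.single i 1))).toAddMonoidHom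

theorem NCTensor.ofFinsupp_finsuppDot {ι : Type*} (β : (ι →₀ Rᵐᵒᵖ) →ₗ[Rᵐᵒᵖ] M)
    (Q : Type u) [AddCommGroup Q] [Module R Q] (f : ι →₀ Rᵐᵒᵖ) (q : Q) :
    NCTensor.ofFinsupp β Q (finsuppDot ι Q f q) = NCTensor.mk R M Q (β f ⊗ₜ q) := by
  induction f using Finsupp.induction_linear with
  | zero => simp
  | add f g hf hg => simp [TensorProduct.add_tmul, hf, hg]
  | single i r =>
    have h1 : finsuppDot ι Q (Finsupp.single i r) q = Finsupp.single i (r.unop • q) := by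
      ext j
      by_cases h : i = j
      · subst h; simp
      · simp [h]
    have h2 : Finsupp.single i r = MulOpposite.op r.unop • Finsupp.single i (1 : Rᵐᵒᵖ) := by
      simp
    rw [h1, h2, map_smul, NCTensor.op_smul_tmul]
    simp [NCTensor.ofFinsupp]

theorem IsLocallyProjective.exists_ofFinsupp_toFinsupp (h : IsLocallyProjective Rᵐᵒᵖ M)
    {Q : Type u} [AddCommGroup Q] [Module R Q] (z : NCTensor R M Q) :
    ∃ (ι : Type u) (α : M →ₗ[Rᵐᵒᵖ] (ι →₀ Rᵐᵒᵖ)) (β : (ι →₀ Rᵐᵒᵖ) →ₗ[Rᵐᵒᵖ] M),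
      NCTensor.ofFinsupp β Q (NCTensor.toFinsupp α Q z) = z := by
  classical
  have key : ∃ C : Finset M, ∀ (ι : Type u) (α : M →ₗ[Rᵐᵒᵖ] (ι →₀ Rᵐᵒᵖ))
      (β : (ι →₀ Rᵐᵒᵖ) →ₗ[Rᵐᵒᵖ] M), (∀ x ∈ C, β (α x) = x) →
      NCTensor.ofFinsupp β Q (NCTensor.toFinsupp α Q z) = z := by
    induction z using NCTensor.induction_on with
    | zero => exact ⟨∅, fun _ _ _ _ => by simp⟩
    | tmul m q =>
      refine ⟨{m}, fun ι α β hC => ?_⟩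
      rw [NCTensor.toFinsupp_mk_tmul, NCTensor.ofFinsupp_finsuppDot, hC m (by simp)]
    | add x y hx hy =>
      obtain ⟨C, hC⟩ := hx
      obtain ⟨C', hC'⟩ := hy
      refine ⟨C ∪ C', fun ι α β h => ?_⟩
      rw [map_add, map_add, hC ι α β fun x hx => h x (by simp [hx]),
        hC' ι α β fun x hx => h x (by simp [hx])]
  obtain ⟨C, hC⟩ := key
  obtain ⟨ι, α, β, hαβ⟩ := h C
  exact ⟨ι, α, β, hC ι α β hαβ⟩

theorem IsLocallyProjective.isRightFlat (h : IsLocallyProjective Rᵐᵒᵖ M) : IsRightFlat R M := by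
  intro Q Q' _ _ _ _ f hf
  rw [injective_iff_map_eq_zero]
  intro z hz
  obtain ⟨ι, α, β, hz'⟩ := h.exists_ofFinsupp_toFinsupp z
  have nat : ∀ w : NCTensor R M Q, NCTensor.toFinsupp α Q' (NCTensor.map f w) =
      Finsupp.mapRange f (map_zero f) (NCTensor.toFinsupp α Q w) := by
    intro w
    induction w using NCTensor.induction_on with
    | zero => simp
    | tmul m q => ext; simp
    | add x y hx hy => rw [map_add, map_add, hx, hy, map_add, Finsupp.mapRange_add (map_add f)]
  have h0 : NCTensor.toFinsupp α Q z = 0 := by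
    have := nat z
    rw [hz, map_zero] at this
    ext j
    exact hf (by simpa using (DFunLike.congr_fun this j).symm)
  rw [← hz', h0, map_zero]

theorem IsLocallyProjective.isMittagLeffler (h : IsLocallyProjective Rᵐᵒᵖ M) :
    IsMittagLeffler R M := by
  intro κ Q _ _
  rw [injective_iff_map_eq_zero]
  intro z hz
  obtain ⟨ι, α, β, hz'⟩ := h.exists_ofFinsupp_toFinsupp z
  have nat : ∀ (w : NCTensor R M (∀ i, Q i)) (k : κ) (j : ι),
      NCTensor.toFinsupp α (Q k) (mlCompare R M Q w k) j =
      NCTensor.toFinsupp α (∀ i, Q i) w j k := by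
    intro w k j
    induction w using NCTensor.induction_on with
    | zero => simp
    | tmul m q => simp
    | add x y hx hy => simp [hx, hy]
  have h0 : NCTensor.toFinsupp α (∀ i, Q i) z = 0 := by
    ext j k
    rw [← nat z k j, hz]
    simp
  rw [← hz', h0, map_zero]

theorem IsLocallyProjective.of_projective {S : Type u} [Ring S] (P : Type u) [AddCommGroup P]
    [Module S P] [Module.Projective S P] : IsLocallyProjective S P := by
  obtain ⟨s, hs⟩ := Module.projective_def'.1 (inferInstance : Module.Projective S P)
  exact fun _ => ⟨P, s, Finsupp.linearCombination S id, fun x _ => LinearMap.congr_fun hs x⟩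

/-- The elementwise form of flatness: every relation between elements of `M` is trivial. -/
def IsEquationallyFlat (S : Type u) [Ring S] (M : Type u) [AddCommGroup M] [Module S M] : Prop :=
  ∀ k : M →₀ S, Finsupp.linearCombination S id k = 0 →
    ∃ φ : (M →₀ S) →ₗ[S] (M →₀ S),
      Finsupp.linearCombination S id ∘ₗ φ = Finsupp.linearCombination S id ∧ φ k = 0

theorem finsuppDot_sum_mem_closure {ι : Type*} {π : (ι →₀ Rᵐᵒᵖ) →ₗ[Rᵐᵒᵖ] M}
    (hπ : Function.Surjective π) {Q : Type u} [AddCommGroup Q] [Module R Q] {J : Type*}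
    (s : Finset J) (f : J → ι →₀ Rᵐᵒᵖ) (q : J → Q)
    (h : ∑ j ∈ s, NCTensor.mk R M Q (π (f j) ⊗ₜ q j) = 0) :
    ∑ j ∈ s, finsuppDot ι Q (f j) (q j) ∈
      AddSubgroup.closure {z | ∃ k, π k = 0 ∧ ∃ q, z = finsuppDot ι Q k q} := by
  set N := AddSubgroup.closure {z | ∃ k, π k = 0 ∧ ∃ q, z = finsuppDot ι Q k q} with hN
  have hmem : ∀ (a b : ι →₀ Rᵐᵒᵖ) (q : Q), π a = π b →
      (QuotientAddGroup.mk' N) (finsuppDot ι Q a q) =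
        (QuotientAddGroup.mk' N) (finsuppDot ι Q b q) := by
    intro a b q hab
    rw [← sub_eq_zero, ← map_sub]
    refine (QuotientAddGroup.eq_zero_iff _).2 (AddSubgroup.subset_closure ⟨a - b, ?_, q, ?_⟩)
    · rw [map_sub, hab, sub_self]
    · simp
  let g := Function.surjInv hπ
  have hg : ∀ m, π (g m) = m := Function.surjInv_eq hπ
  let b : M →+ Q →+ ((ι →₀ Q) ⧸ N) := AddMonoidHom.mk'
    (fun m => (QuotientAddGroup.mk' N).comp (finsuppDot ι Q (g m))) fun x y => by
      ext q
      rw [AddMonoidHom.add_apply]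
      simp only [AddMonoidHom.comp_apply]
      rw [← map_add, ← AddMonoidHom.add_apply, ← map_add]
      exact hmem _ _ _ (by simp [hg])
  let L := NCTensor.lift (R := R) b fun m r q => by
    change QuotientAddGroup.mk' N (finsuppDot ι Q _ _) = QuotientAddGroup.mk' N (finsuppDot ι Q _ _)
    rw [← finsuppDot_op_smul]
    exact hmem _ _ _ (by simp [hg])
  have hL : ∀ f q, L (NCTensor.mk R M Q (π f ⊗ₜ q)) =
      QuotientAddGroup.mk' N (finsuppDot ι Q f q) := by
    intro f q
    exact hmem _ _ _ (hg _)
  have h2 := congrArg L h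
  rw [map_sum, map_zero] at h2
  simp only [hL] at h2
  rw [← map_sum] at h2
  exact (QuotientAddGroup.eq_zero_iff _).1 h2

end TensorLemmas

section Flatness

variable {S : Type u} [Ring S] {M : Type u} [AddCommGroup M] [Module S M]

/-- In an equationally flat module, finitely many relations with respect to any presentation
are simultaneously trivialized. -/
theorem IsEquationallyFlat.exists_end (h : IsEquationallyFlat S M) {ι : Type*}
    (π : (ι →₀ S) →ₗ[S] M) (hπ : Function.Surjective π) (C : Finset (ι →₀ S)) :
    ∃ φ : (ι →₀ S) →ₗ[S] (ι →₀ S), π ∘ₗ φ = π ∧ ∀ c ∈ C, π c = 0 → φ c = 0 := by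
  classical
  obtain ⟨a, ha⟩ := Module.projective_lifting_property (Finsupp.linearCombination S (id : M → M)) π
    (Finsupp.linearCombination_id_surjective S M)
  obtain ⟨b, hb⟩ := Module.projective_lifting_property π (Finsupp.linearCombination S (id : M → M))
    hπ
  induction C using Finset.induction_on with
  | empty => exact ⟨LinearMap.id, rfl, by simp⟩
  | insert c C _ ih =>
    obtain ⟨φ, hφ, hC⟩ := ih
    by_cases hc : π c = 0
    · obtain ⟨ψ, hψ, hψc⟩ := h (a (φ c)) (by
        rw [← LinearMap.comp_apply, ha, ← LinearMap.comp_apply, hφ, hc])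
      refine ⟨b ∘ₗ ψ ∘ₗ a ∘ₗ φ, ?_, ?_⟩
      · rw [← LinearMap.comp_assoc, hb, ← LinearMap.comp_assoc, hψ, ← LinearMap.comp_assoc, ha, hφ]
      · intro d hd hd0
        rcases Finset.mem_insert.1 hd with rfl | hd
        · simp [hψc]
        · simp [hC d hd hd0]
    · refine ⟨φ, hφ, fun d hd hd0 => ?_⟩
      rcases Finset.mem_insert.1 hd with rfl | hd
      · exact absurd hd0 hc
      · exact hC d hd hd0

/-- A finite tuple in `M` has a lift to the canonical free cover from which no further
cancellation is possible. This is the elementwise form of the Mittag-Leffler property. -/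
def HasMinimalLifts (S : Type u) [Ring S] (M : Type u) [AddCommGroup M] [Module S M] : Prop :=
  ∀ (n : ℕ) (x : Fin n → M), ∃ f : Fin n → (M →₀ S),
    (∀ i, Finsupp.linearCombination S id (f i) = x i) ∧
    ∀ f' : Fin n → (M →₀ S), (∀ i, Finsupp.linearCombination S id (f' i) = x i) →
      ∃ θ : (M →₀ S) →ₗ[S] (M →₀ S), ∀ i, θ (f' i) = f i

end Flatness

section TensorFlatness

variable {R : Type u} [Ring R] {M : Type u} [AddCommGroup M] [Module Rᵐᵒᵖ M]

theorem IsRightFlat.isEquationallyFlat (h : IsRightFlat R M) : IsEquationallyFlat Rᵐᵒᵖ M := by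
  classical
  intro k hk
  let π := Finsupp.linearCombination Rᵐᵒᵖ (id : M → M)
  let I : Submodule R R := Submodule.span R (Set.range fun j : k.support => (k j).unop)
  let r : M → I := fun j => if hj : j ∈ k.support then
    ⟨(k j).unop, Submodule.subset_span ⟨⟨j, hj⟩, rfl⟩⟩ else 0
  have hr : ∀ j, (r j : R) = (k j).unop := by
    intro j
    by_cases hj : j ∈ k.support
    · simp only [r, hj, dif_pos]
    · simp only [r, hj, dif_neg, not_false_eq_true]
      rw [Finsupp.notMem_support_iff.1 hj]; rfl
  have h0 : ∑ j ∈ k.support, NCTensor.mk R M I (π (Finsupp.single j 1) ⊗ₜ r j) = 0 := by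
    apply h I R I.subtype I.injective_subtype
    rw [map_zero, map_sum]
    have e : ∀ j : M, NCTensor.map I.subtype (NCTensor.mk R M I (π (Finsupp.single j 1) ⊗ₜ r j)) =
        NCTensor.mk R M R ((k j • j) ⊗ₜ (1 : R)) := by
      intro j
      have h1 : k j = MulOpposite.op (r j : R) := by rw [hr, MulOpposite.op_unop]
      rw [NCTensor.map_mk_tmul, h1, NCTensor.op_smul_tmul]
      simp [π]
    simp only [e]
    rw [← map_sum, ← TensorProduct.sum_tmul]
    have : ∑ j ∈ k.support, k j • j = 0 := by
      rw [← hk, Finsupp.linearCombination_apply]; rfl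
    rw [this, TensorProduct.zero_tmul, map_zero]
  have h1 := finsuppDot_sum_mem_closure (π := π) (Finsupp.linearCombination_id_surjective _ M)
    k.support (fun j => Finsupp.single j 1) r h0
  have h2 : ∀ z ∈ AddSubgroup.closure {z | ∃ k, π k = 0 ∧ ∃ q, z = finsuppDot M I k q},
      ∃ κ : M → M →₀ Rᵐᵒᵖ, (∀ j, π (κ j) = 0) ∧ z = ∑ j ∈ k.support, finsuppDot M I (κ j) (r j) := by
    intro z hz
    induction hz using AddSubgroup.closure_induction with
    | mem z hz =>
      obtain ⟨κ, hκ, q, rfl⟩ := hz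
      obtain ⟨c, hc⟩ := (Submodule.mem_span_range_iff_exists_fun R).1 q.2
      refine ⟨fun j => if hj : j ∈ k.support then MulOpposite.op (c ⟨j, hj⟩) • κ else 0, ?_, ?_⟩
      · intro j
        dsimp only
        split_ifs <;> simp [hκ]
      · rw [← Finset.sum_coe_sort k.support]
        have : q = ∑ j : k.support, c j • r j := by
          apply Subtype.ext
          rw [← hc]
          simp [hr]
        rw [this, map_sum]
        refine Finset.sum_congr rfl fun j _ => ?_
        dsimp only
        rw [dif_pos j.2, finsuppDot_op_smul]
    | zero => exact ⟨0, by simp, by simp⟩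
    | add x y _ _ hx hy =>
      obtain ⟨κ, hκ, rfl⟩ := hx
      obtain ⟨κ', hκ', rfl⟩ := hy
      exact ⟨κ + κ', by simp [hκ, hκ'], by simp [Finset.sum_add_distrib]⟩
    | neg x _ hx =>
      obtain ⟨κ, hκ, rfl⟩ := hx
      exact ⟨-κ, by simp [hκ], by simp⟩
  obtain ⟨κ, hκ, hz⟩ := h2 _ h1
  have hπκ : π ∘ₗ Finsupp.linearCombination Rᵐᵒᵖ κ = 0 := by
    ext j; simp [hκ]
  have hκk : Finsupp.linearCombination Rᵐᵒᵖ κ k = k := by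
    ext l
    have h3 := congrArg (fun q : I => (q : R)) (DFunLike.congr_fun hz l)
    simp only [Finsupp.finsetSum_apply, finsuppDot_apply, AddSubmonoidClass.coe_finsetSum,
      Submodule.coe_smul, hr, smul_eq_mul, Finsupp.single_apply] at h3
    rw [Finsupp.linearCombination_apply, Finsupp.sum, Finsupp.finsetSum_apply]
    apply MulOpposite.unop_injective
    rw [Finset.unop_sum]
    simp only [Finsupp.smul_apply, smul_eq_mul, MulOpposite.unop_mul]
    rw [← h3]
    by_cases hl : l ∈ k.support
    · rw [Finset.sum_eq_single l]
      · simp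
      · intro b _ hb; simp [hb]
      · intro h; exact absurd hl h
    · rw [Finset.sum_eq_zero]
      · rw [Finsupp.notMem_support_iff.1 hl]; rfl
      · intro b hb
        have : b ≠ l := fun h => hl (h ▸ hb)
        simp [this]
  refine ⟨LinearMap.id - Finsupp.linearCombination Rᵐᵒᵖ κ, ?_, ?_⟩
  · rw [LinearMap.comp_sub, LinearMap.comp_id]
    change π - π ∘ₗ _ = π
    rw [hπκ, sub_zero]
  · simp [hκk]

/-- Over an equationally flat module, a vanishing sum of tensors can be lifted to a vanishing
sum of tensors over a free module. -/
theorem IsEquationallyFlat.exists_lift_of_sum_tmul_eq_zero (h : IsEquationallyFlat Rᵐᵒᵖ M)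
    {Q : Type u} [AddCommGroup Q] [Module R Q] {n : ℕ} (x : Fin n → M) (q : Fin n → Q)
    (h0 : ∑ i, NCTensor.mk R M Q (x i ⊗ₜ q i) = 0) :
    ∃ f : Fin n → (M →₀ Rᵐᵒᵖ), (∀ i, Finsupp.linearCombination Rᵐᵒᵖ id (f i) = x i) ∧
      ∀ j, ∑ i, (f i j).unop • q i = 0 := by
  classical
  let π := Finsupp.linearCombination Rᵐᵒᵖ (id : M → M)
  have hπ : Function.Surjective π := Finsupp.linearCombination_id_surjective _ M
  let g : Fin n → (M →₀ Rᵐᵒᵖ) := fun i => Finsupp.single (x i) 1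
  have hg : ∀ i, π (g i) = x i := fun i => by simp [π, g]
  have h1 := finsuppDot_sum_mem_closure hπ Finset.univ g q (by simpa [hg] using h0)
  let act (φ : (M →₀ Rᵐᵒᵖ) →ₗ[Rᵐᵒᵖ] (M →₀ Rᵐᵒᵖ)) : (M →₀ Q) →+ (M →₀ Q) :=
    Finsupp.liftAddHom fun j => finsuppDot M Q (φ (Finsupp.single j 1))
  have hact : ∀ φ f q, act φ (finsuppDot M Q f q) = finsuppDot M Q (φ f) q := by
    intro φ f q
    induction f using Finsupp.induction_linear with
    | zero => simp
    | add f g hf hg => simp [hf, hg]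
    | single i r =>
      have h1 : finsuppDot M Q (Finsupp.single i r) q = Finsupp.single i (r.unop • q) := by
        ext j
        by_cases h : i = j
        · subst h; simp
        · simp [h]
      have h2 : Finsupp.single i r = MulOpposite.op r.unop • Finsupp.single i (1 : Rᵐᵒᵖ) := by
        simp
      rw [h1, h2, map_smul, finsuppDot_op_smul]
      simp [act]
  have h2 : ∀ z ∈ AddSubgroup.closure {z | ∃ k, π k = 0 ∧ ∃ q, z = finsuppDot M Q k q},
      ∃ C : Finset (M →₀ Rᵐᵒᵖ), ∀ φ, (∀ c ∈ C, π c = 0 → φ c = 0) → act φ z = 0 := by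
    intro z hz
    induction hz using AddSubgroup.closure_induction with
    | mem z hz =>
      obtain ⟨κ, hκ, q, rfl⟩ := hz
      exact ⟨{κ}, fun φ hφ => by rw [hact, hφ κ (by simp) hκ]; simp⟩
    | zero => exact ⟨∅, by simp⟩
    | add x y _ _ hx hy =>
      obtain ⟨C, hC⟩ := hx
      obtain ⟨C', hC'⟩ := hy
      refine ⟨C ∪ C', fun φ hφ => ?_⟩
      rw [map_add, hC φ fun c hc => hφ c (by simp [hc]), hC' φ fun c hc => hφ c (by simp [hc]),
        add_zero]
    | neg x _ hx =>
      obtain ⟨C, hC⟩ := hx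
      exact ⟨C, fun φ hφ => by rw [map_neg, hC φ hφ, neg_zero]⟩
  obtain ⟨C, hC⟩ := h2 _ h1
  obtain ⟨φ, hφ, hφC⟩ := h.exists_end π hπ C
  refine ⟨fun i => φ (g i), fun i => ?_, fun j => ?_⟩
  · rw [← hg i]
    exact LinearMap.congr_fun hφ (g i)
  · have := DFunLike.congr_fun (hC φ hφC) j
    rw [map_sum] at this
    simpa [hact, Finsupp.finsetSum_apply] using this

theorem IsMittagLeffler.hasMinimalLifts (hF : IsRightFlat R M) (hM : IsMittagLeffler R M) :
    HasMinimalLifts Rᵐᵒᵖ M := by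
  classical
  intro n x
  let π := Finsupp.linearCombination Rᵐᵒᵖ (id : M → M)
  let Ω := {f' : Fin n → (M →₀ Rᵐᵒᵖ) // ∀ i, π (f' i) = x i}
  let N : Ω → Submodule R (Fin n → R) := fun f' =>
    Submodule.span R (Set.range fun (j : M) (i : Fin n) => (f'.1 i j).unop)
  let q : Fin n → ∀ f' : Ω, (Fin n → R) ⧸ N f' := fun i f' => (N f').mkQ (Pi.single i 1)
  have hq : ∀ (c : Fin n → R) (f' : Ω), ∑ i, c i • q i f' = (N f').mkQ c := by
    intro c f'
    simp only [q, ← map_smul, ← map_sum]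
    congr 1
    ext i
    simp [Finset.sum_apply, Pi.single_apply]
  have h0 : ∑ i, NCTensor.mk R M (∀ f', (Fin n → R) ⧸ N f') (x i ⊗ₜ q i) = 0 := by
    apply hM Ω (fun f' => (Fin n → R) ⧸ N f')
    rw [map_zero, map_sum]
    funext f'
    rw [Finset.sum_apply]
    simp only [mlCompare_mk_tmul, Pi.zero_apply]
    have e : ∀ i, NCTensor.mk R M ((Fin n → R) ⧸ N f') (x i ⊗ₜ q i f') =
        NCTensor.ofFinsupp π _ (finsuppDot M _ (f'.1 i) (q i f')) := by
      intro i
      rw [NCTensor.ofFinsupp_finsuppDot, f'.2 i]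
    simp only [e]
    rw [← map_sum]
    suffices h : ∑ i, finsuppDot M _ (f'.1 i) (q i f') = 0 by rw [h, map_zero]
    ext j
    rw [Finsupp.finsetSum_apply]
    simp only [finsuppDot_apply, Finsupp.coe_zero, Pi.zero_apply]
    rw [hq (fun i => (f'.1 i j).unop)]
    exact (Submodule.Quotient.mk_eq_zero _).2 (Submodule.subset_span ⟨j, rfl⟩)
  obtain ⟨f, hf, hf0⟩ := hF.isEquationallyFlat.exists_lift_of_sum_tmul_eq_zero x q h0
  refine ⟨f, hf, fun f' hf' => ?_⟩
  have h3 : ∀ j, ∃ c : M →₀ R, ∀ i, ∑ l ∈ c.support, c l * (f' i l).unop = (f i j).unop := by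
    intro j
    have h4 := congrFun (hf0 j) ⟨f', hf'⟩
    rw [Finset.sum_apply] at h4
    simp only [Pi.smul_apply, Pi.zero_apply] at h4
    rw [hq (fun i => (f i j).unop)] at h4
    obtain ⟨c, hc⟩ := Finsupp.mem_span_range_iff_exists_finsupp.1
      ((Submodule.Quotient.mk_eq_zero _).1 h4)
    refine ⟨c, fun i => ?_⟩
    have := congrFun hc i
    simpa [Finsupp.sum] using this
  choose c hc using h3
  let J : Finset M := Finset.univ.biUnion fun i => (f i).support
  refine ⟨∑ j ∈ J, (LinearMap.toSpanSingleton Rᵐᵒᵖ (M →₀ Rᵐᵒᵖ) (Finsupp.single j 1)).comp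
    (Finsupp.linearCombination Rᵐᵒᵖ fun l => MulOpposite.op (c j l)), fun i => ?_⟩
  have h5 : ∀ j, Finsupp.linearCombination Rᵐᵒᵖ (fun l => MulOpposite.op (c j l)) (f' i) = f i j := by
    intro j
    apply MulOpposite.unop_injective
    rw [← hc j i, Finsupp.linearCombination_apply, Finsupp.sum_of_support_subset
      (s := (f' i).support ∪ (c j).support) _ Finset.subset_union_left _ (by simp),
      Finset.unop_sum]
    rw [← Finset.sum_subset (s₁ := (c j).support) (s₂ := (f' i).support ∪ (c j).support)
      Finset.subset_union_right]
    · simp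
    · intro l _ hl
      simp [Finsupp.notMem_support_iff.1 hl]
  rw [LinearMap.sum_apply]
  simp only [LinearMap.comp_apply, h5, LinearMap.toSpanSingleton_apply]
  ext l
  rw [Finsupp.finsetSum_apply]
  simp only [Finsupp.smul_apply, smul_eq_mul, Finsupp.single_apply, mul_ite, mul_one, mul_zero,
    Finset.sum_ite_eq']
  split_ifs with hl
  · rfl
  · by_contra h
    exact hl (Finset.mem_biUnion.2 ⟨i, Finset.mem_univ _, Finsupp.mem_support_iff.2 (Ne.symm h)⟩)

end TensorFlatness

section CountableProjective

variable {S : Type u} [Ring S]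

theorem LinearMap.exists_comp_eq_of_ker_le {F B G : Type*} [AddCommGroup F] [Module S F]
    [AddCommGroup B] [Module S B] [AddCommGroup G] [Module S G] {π : F →ₗ[S] B}
    (hπ : Function.Surjective π) (e : F →ₗ[S] G) (he : ∀ k, π k = 0 → e k = 0) :
    ∃ s : B →ₗ[S] G, s ∘ₗ π = e := by
  refine ⟨(LinearMap.ker π).liftQ e (fun k hk => he k hk) ∘ₗ
    (π.quotKerEquivOfSurjective hπ).symm.toLinearMap, ?_⟩
  ext x
  have : (π.quotKerEquivOfSurjective hπ).symm (π x) = Submodule.Quotient.mk x := by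
    rw [LinearEquiv.symm_apply_eq]; rfl
  simp only [LinearMap.comp_apply, LinearEquiv.coe_coe, this]
  rfl

/-- Minimal lifts are inherited by direct summands and do not depend on the free cover. -/
theorem HasMinimalLifts.exists_of_retract {X B : Type u} [AddCommGroup X] [Module S X]
    [AddCommGroup B] [Module S B] (hX : HasMinimalLifts S X) {σ : B →ₗ[S] X} {ρ : X →ₗ[S] B}
    (hρσ : ρ ∘ₗ σ = LinearMap.id) {ι : Type*} {π : (ι →₀ S) →ₗ[S] B}
    (hπ : Function.Surjective π) {n : ℕ} (x : Fin n → B) :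
    ∃ f : Fin n → (ι →₀ S), (∀ i, π (f i) = x i) ∧
      ∀ f' : Fin n → (ι →₀ S), (∀ i, π (f' i) = x i) →
        ∃ θ : (ι →₀ S) →ₗ[S] (ι →₀ S), ∀ i, θ (f' i) = f i := by
  obtain ⟨f, hf, hmin⟩ := hX n fun i => σ (x i)
  obtain ⟨l, hl⟩ := Module.projective_lifting_property π
    (ρ ∘ₗ Finsupp.linearCombination S (id : X → X)) hπ
  obtain ⟨μ, hμ⟩ := Module.projective_lifting_property (Finsupp.linearCombination S (id : X → X))
    (σ ∘ₗ π) (Finsupp.linearCombination_id_surjective S X)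
  refine ⟨fun i => l (f i), fun i => ?_, fun f' hf' => ?_⟩
  · have h1 := LinearMap.congr_fun hl (f i)
    simp only [LinearMap.comp_apply] at h1
    rw [h1, hf]
    exact LinearMap.congr_fun hρσ (x i)
  · obtain ⟨θ, hθ⟩ := hmin (fun i => μ (f' i)) fun i => by
      have h1 := LinearMap.congr_fun hμ (f' i)
      simp only [LinearMap.comp_apply] at h1
      rw [h1, hf']
    exact ⟨l ∘ₗ θ ∘ₗ μ, fun i => by simp [hθ]⟩

theorem IsEquationallyFlat.projective_of_minimalLifts {B : Type u} [AddCommGroup B] [Module S B]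
    [Countable S] (hB : IsEquationallyFlat S B) {π : (ℕ →₀ S) →ₗ[S] B}
    (hπ : Function.Surjective π)
    (hmin : ∀ (n : ℕ) (x : Fin n → B), ∃ f : Fin n → (ℕ →₀ S), (∀ i, π (f i) = x i) ∧
      ∀ f' : Fin n → (ℕ →₀ S), (∀ i, π (f' i) = x i) →
        ∃ θ : (ℕ →₀ S) →ₗ[S] (ℕ →₀ S), ∀ i, θ (f' i) = f i) :
    Module.Projective S B := by
  classical
  obtain ⟨k, hk⟩ := exists_surjective_nat (ℕ →₀ S)
  let b : ℕ → (ℕ →₀ S) := fun i => Finsupp.single i 1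
  choose f hf hfmin using fun n : ℕ => hmin n fun i => π (b i)
  have step : ∀ (n : ℕ) (h : (ℕ →₀ S) →ₗ[S] (ℕ →₀ S)) (C : Finset (ℕ →₀ S)), π ∘ₗ h = π →
      ∃ h' : (ℕ →₀ S) →ₗ[S] (ℕ →₀ S), π ∘ₗ h' = π ∧ (∀ i, h' (f n i) = h (f n i)) ∧
        ∀ c ∈ C, π c = 0 → h' c = 0 := by
    intro n h C hh
    obtain ⟨φ, hφ, hφC⟩ := hB.exists_end π hπ C
    obtain ⟨θ, hθ⟩ := hfmin n (fun i => φ (f n i)) fun i => by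
      rw [← hf n i]; exact LinearMap.congr_fun hφ _
    refine ⟨φ + (h - φ) ∘ₗ θ ∘ₗ φ, ?_, fun i => ?_, fun c hc hc0 => ?_⟩
    · rw [LinearMap.comp_add, ← LinearMap.comp_assoc, LinearMap.comp_sub, hφ, hh]
      simp
    · simp [hθ]
    · simp [hφC c hc hc0]
  let C : ℕ → Finset (ℕ →₀ S) := fun n => (Finset.range (n + 1)).image k ∪
    (Finset.univ.image (fun i : Fin n => b i - f n i) ∪
      Finset.univ.image (fun i : Fin (n + 1) => b i - f (n + 1) i))
  choose! next hnext using step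
  let h : ℕ → (ℕ →₀ S) →ₗ[S] (ℕ →₀ S) := fun n => Nat.rec LinearMap.id (fun n g => next n g (C n)) n
  have hsucc : ∀ n, h (n + 1) = next n (h n) (C n) := fun n => rfl
  have hh : ∀ n, π ∘ₗ h n = π := by
    intro n
    induction n with
    | zero => rfl
    | succ n ih => rw [hsucc]; exact (hnext n (h n) (C n) ih).1
  have hkill : ∀ n, ∀ c ∈ C n, π c = 0 → h (n + 1) c = 0 := fun n =>
    (hnext n (h n) (C n) (hh n)).2.2
  have hkeep : ∀ n i, h (n + 1) (f n i) = h n (f n i) := fun n =>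
    (hnext n (h n) (C n) (hh n)).2.1
  have hπb : ∀ n (i : Fin n), π (b i - f n i) = 0 := fun n i => by rw [map_sub, hf, sub_self]
  have hstable : ∀ i d, h (i + 1 + d) (b i) = h (i + 1) (b i) := by
    intro i d
    induction d with
    | zero => rfl
    | succ d ih =>
      have hi : i < i + 1 + d := by omega
      have h1 : h (i + 1 + d + 1) (b i - f (i + 1 + d) ⟨i, hi⟩) = 0 :=
        hkill _ _ (by simp only [C, Finset.mem_union, Finset.mem_image]
                      exact Or.inr (Or.inl ⟨⟨i, hi⟩, Finset.mem_univ _, rfl⟩)) (hπb _ ⟨i, hi⟩)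
      have h2 : h (i + 1 + d) (b i - f (i + 1 + d) ⟨i, hi⟩) = 0 := by
        obtain ⟨m, hm⟩ : ∃ m, i + 1 + d = m + 1 := ⟨i + d, by omega⟩
        have hc : ∀ p, (hp : p = m + 1) → (hi' : i < p) → h p (b i - f p ⟨i, hi'⟩) = 0 := by
          rintro p rfl hi'
          exact hkill _ _ (by simp only [C, Finset.mem_union, Finset.mem_image]
                              exact Or.inr (Or.inr ⟨⟨i, hi'⟩, Finset.mem_univ _, rfl⟩))
            (hπb _ ⟨i, hi'⟩)
        exact hc _ hm hi
      rw [map_sub, sub_eq_zero] at h1 h2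
      rw [← ih, h2, ← hkeep, ← h1]
      rfl
  let e : (ℕ →₀ S) →ₗ[S] (ℕ →₀ S) := Finsupp.linearCombination S fun i => h (i + 1) (b i)
  have heb : ∀ i, e (b i) = h (i + 1) (b i) := fun i => by simp [e, b]
  have hev : ∀ x, ∃ m₀, ∀ m ≥ m₀, e x = h m x := by
    intro x
    induction x using Finsupp.induction_linear with
    | zero => exact ⟨0, by simp⟩
    | add x y hx hy =>
      obtain ⟨m, hm⟩ := hx
      obtain ⟨m', hm'⟩ := hy
      exact ⟨max m m', fun p hp => by
        rw [map_add, map_add, hm p (le_of_max_le_left hp), hm' p (le_of_max_le_right hp)]⟩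
    | single i r =>
      refine ⟨i + 1, fun m hm => ?_⟩
      obtain ⟨d, rfl⟩ := Nat.exists_eq_add_of_le hm
      have : Finsupp.single i r = r • b i := by simp [b]
      rw [this, map_smul, map_smul, heb, hstable]
  have he0 : ∀ x, π x = 0 → e x = 0 := by
    intro x hx
    obtain ⟨j, rfl⟩ := hk x
    obtain ⟨m, hm⟩ := hev (k j)
    rw [hm (max m j + 1) (by omega)]
    refine hkill _ _ ?_ hx
    simp only [C, Finset.mem_union, Finset.mem_image]
    exact Or.inl ⟨j, by simp, rfl⟩
  obtain ⟨s, hs⟩ := LinearMap.exists_comp_eq_of_ker_le hπ e he0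
  refine Module.Projective.of_split s π ?_
  ext x
  obtain ⟨x, rfl⟩ := hπ x
  obtain ⟨m, hm⟩ := hev x
  have h1 := LinearMap.congr_fun hs x
  simp only [LinearMap.comp_apply] at h1
  rw [LinearMap.comp_apply, h1, hm m le_rfl]
  exact LinearMap.congr_fun (hh m) x

/-- A countable flat module is the direct limit of a sequence of endomorphisms of a free module
of countable rank. -/
theorem IsEquationallyFlat.exists_sequence {B : Type u} [AddCommGroup B] [Module S B]
    [Countable S] (hB : IsEquationallyFlat S B) {π : (ℕ →₀ S) →ₗ[S] B}
    (hπ : Function.Surjective π) :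
    ∃ U : ℕ → ℕ → (ℕ →₀ S) →ₗ[S] (ℕ →₀ S), (∀ n, U n n = LinearMap.id) ∧
      (∀ l n m, l ≤ n → n ≤ m → U n m ∘ₗ U l n = U l m) ∧ (∀ n m, π ∘ₗ U n m = π) ∧
      ∀ n x, π x = 0 → ∃ m₀, ∀ m ≥ m₀, U n m x = 0 := by
  classical
  obtain ⟨k, hk⟩ := exists_surjective_nat (ℕ →₀ S)
  choose κ hκ hκC using hB.exists_end π hπ
  let fam : ℕ → (ℕ → (ℕ →₀ S) →ₗ[S] (ℕ →₀ S)) → Finset (ℕ →₀ S) := fun m Ψ =>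
    (Finset.range (m + 1) ×ˢ Finset.range (m + 1)).image fun p => Ψ p.1 (k p.2)
  let st : ℕ → (ℕ → (ℕ →₀ S) →ₗ[S] (ℕ →₀ S)) := fun m => Nat.rec (fun _ => LinearMap.id)
    (fun m Ψ n => if n ≤ m then κ (fam m Ψ) ∘ₗ Ψ n else LinearMap.id) m
  have hst : ∀ m n, n ≤ m → st (m + 1) n = κ (fam m (st m)) ∘ₗ st m n := fun m n h => if_pos h
  have hst' : ∀ m n, m < n → st (m + 1) n = LinearMap.id := fun m n h => if_neg (by omega)
  have hid : ∀ n, st n n = LinearMap.id := by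
    intro n
    cases n with
    | zero => rfl
    | succ n => exact hst' _ _ (by omega)
  have hπst : ∀ m n, π ∘ₗ st m n = π := by
    intro m n
    induction m with
    | zero => rfl
    | succ m ih =>
      by_cases h : n ≤ m
      · rw [hst m n h, ← LinearMap.comp_assoc, hκ, ih]
      · rw [hst' m n (by omega)]; rfl
  have hcomp : ∀ l n m, l ≤ n → n ≤ m → st m n ∘ₗ st n l = st m l := by
    intro l n m hl hm
    induction m, hm using Nat.le_induction with
    | base => rw [hid]; rfl
    | succ m hm ih => rw [hst m n hm, hst m l (by omega), LinearMap.comp_assoc, ih]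
  refine ⟨fun n m => st m n, hid, hcomp, fun n m => hπst m n, fun n x hx => ?_⟩
  obtain ⟨i, rfl⟩ := hk x
  refine ⟨max n i + 1, fun m hm => ?_⟩
  have h1 : st (max n i + 1) n (k i) = 0 := by
    rw [hst _ _ (le_max_left _ _)]
    refine hκC _ _ (Finset.mem_image.2 ⟨(n, i), by simp, rfl⟩) ?_
    have := LinearMap.congr_fun (hπst (max n i) n) (k i)
    rw [LinearMap.comp_apply] at this
    rw [this, hx]
  change st m n (k i) = 0
  rw [← hcomp n (max n i + 1) m (by omega) hm, LinearMap.comp_apply, h1, map_zero]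

end CountableProjective

section TreeModule

variable {S : Type u} [Ring S]

/-- The initial segment of length `n` of an infinite branch, as a node of the tree of finite
sequences. -/
def branchNode {A : Type*} (η : ℕ → A) (n : ℕ) : Σ n, (Fin n → A) := ⟨n, fun i => η i⟩

theorem eventually_injOn_branchNode {A : Type*} (H : Finset (ℕ → A)) :
    ∀ᶠ N in Filter.atTop, ∀ η ∈ H, ∀ η' ∈ H, branchNode η N = branchNode η' N → η = η' := by
  rw [Filter.eventually_all_finset]
  intro η _
  rw [Filter.eventually_all_finset]
  intro η' _
  by_cases h : η = η'
  · exact Filter.Eventually.of_forall fun _ _ => h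
  · obtain ⟨i, hi⟩ := Function.ne_iff.1 h
    filter_upwards [Filter.eventually_gt_atTop i] with N hN hN'
    exact absurd (congrFun (eq_of_heq (Sigma.mk.inj hN').2) ⟨i, hN⟩) hi

/-- The tree module of a sequence of endomorphisms `U n m` of a free module whose direct limit
is `B`: a locally projective module which is an extension of a direct sum of copies of `B`
indexed by the branches of a tree, by a free module indexed by the nodes of the tree. -/
theorem exists_treeModule {B : Type u} [AddCommGroup B] [Module S B] {π : (ℕ →₀ S) →ₗ[S] B}
    {U : ℕ → ℕ → (ℕ →₀ S) →ₗ[S] (ℕ →₀ S)}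
    (hcomp : ∀ l n m, l ≤ n → n ≤ m → U n m ∘ₗ U l n = U l m) (hπU : ∀ n m, π ∘ₗ U n m = π)
    (hker : ∀ n x, π x = 0 → ∃ m₀, ∀ m ≥ m₀, U n m x = 0) (A : Type u) :
    ∃ (L : Type u) (_ : AddCommGroup L) (_ : Module S L)
      (E : (Σ n, (Fin n → A)) → (ℕ →₀ S) →ₗ[S] L) (Y : (ℕ → A) → (ℕ →₀ S) →ₗ[S] L)
      (b : L →ₗ[S] ((ℕ → A) →₀ B)), IsLocallyProjective S L ∧ (∀ s, b ∘ₗ E s = 0) ∧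
      (∀ η x, b (Y η x) = Finsupp.single η (π x)) ∧
      ∀ η x, π x = 0 → Y η x ∈ ⨆ s, LinearMap.range (E s) := by
  classical
  let T := Σ n, (Fin n → A)
  let P := (T → (ℕ →₀ S)) × ((ℕ → A) →₀ B)
  let e : T → (ℕ →₀ S) →ₗ[S] P := fun s =>
    (LinearMap.single S (fun _ : T => ℕ →₀ S) s).prod 0
  let y : ℕ → (ℕ → A) → (ℕ →₀ S) →ₗ[S] P := fun n η =>
    (LinearMap.pi fun t => if n ≤ t.1 ∧ branchNode η t.1 = t then U n t.1 else 0).prod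
      (Finsupp.lsingle η ∘ₗ π)
  have he1 : ∀ s x t, (e s x).1 t = if s = t then x else 0 := by
    intro s x t
    change (Pi.single s x : T → (ℕ →₀ S)) t = _
    by_cases h : s = t
    · subst h; simp
    · rw [if_neg h, Pi.single_eq_of_ne (Ne.symm h)]
  have he2 : ∀ s x, (e s x).2 = 0 := fun s x => rfl
  have hy1 : ∀ n η x t, (y n η x).1 t = if n ≤ t.1 ∧ branchNode η t.1 = t then U n t.1 x else 0 := by
    intro n η x t
    change (if n ≤ t.1 ∧ branchNode η t.1 = t then U n t.1 else 0) x = _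
    split_ifs <;> rfl
  have hy2 : ∀ n η x, (y n η x).2 = Finsupp.single η (π x) := fun n η x => rfl
  let L : Submodule S P := (⨆ s, LinearMap.range (e s)) ⊔ ⨆ p : ℕ × (ℕ → A),
    LinearMap.range (y p.1 p.2)
  have heL : ∀ s x, e s x ∈ L := fun s x =>
    Submodule.mem_sup_left (Submodule.mem_iSup_of_mem s ⟨x, rfl⟩)
  have hyL : ∀ n η x, y n η x ∈ L := fun n η x =>
    Submodule.mem_sup_right (Submodule.mem_iSup_of_mem (n, η) ⟨x, rfl⟩)
  let E : T → (ℕ →₀ S) →ₗ[S] L := fun s => (e s).codRestrict L (heL s)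
  let Y : ℕ → (ℕ → A) → (ℕ →₀ S) →ₗ[S] L := fun n η => (y n η).codRestrict L (hyL n η)
  refine ⟨L, inferInstance, inferInstance, E, Y 0, LinearMap.snd S _ _ ∘ₗ L.subtype, ?_,
    fun s => by ext; rfl, fun η x => rfl, ?_⟩
  · -- `θ T₀ H N` is the endomorphism that reads a vector off from its coordinates at the nodes
    -- in `nodes T₀ H N` and at the `N`-th nodes of the branches in `H`
    let nodes : Finset T → Finset (ℕ → A) → ℕ → Finset T := fun T₀ H N =>
      T₀.filter (fun t => t.1 < N) ∪ H.biUnion fun η => (Finset.range N).image (branchNode η)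
    have hlt : ∀ T₀ H N, ∀ t ∈ nodes T₀ H N, t.1 < N := by
      intro T₀ H N t ht
      rcases Finset.mem_union.1 ht with ht | ht
      · exact (Finset.mem_filter.1 ht).2
      · obtain ⟨η, _, ht⟩ := Finset.mem_biUnion.1 ht
        obtain ⟨m, hm, rfl⟩ := Finset.mem_image.1 ht
        exact Finset.mem_range.1 hm
    let θ : Finset T → Finset (ℕ → A) → ℕ → P →ₗ[S] P := fun T₀ H N =>
      (∑ s ∈ nodes T₀ H N, e s ∘ₗ LinearMap.proj s ∘ₗ LinearMap.fst S _ _) +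
        ∑ η ∈ H, y N η ∘ₗ LinearMap.proj (branchNode η N) ∘ₗ LinearMap.fst S _ _
    have hθ : ∀ T₀ H N z, θ T₀ H N z = (∑ s ∈ nodes T₀ H N, e s (z.1 s)) +
        ∑ η ∈ H, y N η (z.1 (branchNode η N)) := by
      intro T₀ H N z
      simp [θ, LinearMap.sum_apply]
      rfl
    have hfix_e : ∀ s x, ∀ᶠ p : Finset T × Finset (ℕ → A) in Filter.atTop,
        ∀ᶠ N in Filter.atTop, θ p.1 p.2 N (e s x) = e s x := by
      intro s x
      filter_upwards [Filter.eventually_ge_atTop (({s} : Finset T), (∅ : Finset (ℕ → A)))] with p hp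
      filter_upwards [Filter.eventually_gt_atTop s.1] with N hN
      rw [hθ, Finset.sum_eq_single s, Finset.sum_eq_zero, add_zero, he1, if_pos rfl]
      · intro η _
        rw [he1, if_neg, map_zero]
        rintro h
        rw [h] at hN
        exact lt_irrefl _ hN
      · intro t _ ht
        rw [he1, if_neg (Ne.symm ht), map_zero]
      · intro h
        exact absurd (Finset.mem_union_left _
          (Finset.mem_filter.2 ⟨hp.1 (Finset.mem_singleton_self s), hN⟩)) h
    have hfix_y : ∀ n η x, ∀ᶠ p : Finset T × Finset (ℕ → A) in Filter.atTop,
        ∀ᶠ N in Filter.atTop, θ p.1 p.2 N (y n η x) = y n η x := by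
      intro n η x
      filter_upwards [Filter.eventually_ge_atTop ((∅ : Finset T), ({η} : Finset (ℕ → A)))] with p hp
      have hη : η ∈ p.2 := hp.2 (Finset.mem_singleton_self η)
      filter_upwards [eventually_injOn_branchNode p.2, Filter.eventually_ge_atTop n] with N hN hnN
      have hsum : ∑ η' ∈ p.2, y N η' ((y n η x).1 (branchNode η' N)) = y N η (U n N x) := by
        rw [Finset.sum_eq_single η]
        · rw [hy1, if_pos ⟨hnN, rfl⟩]; rfl
        · intro η' hη' hne
          rw [hy1, if_neg, map_zero]
          rintro ⟨_, h⟩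
          exact hne (hN η' hη' η hη h.symm)
        · exact fun h => absurd hη h
      rw [hθ, hsum]
      refine Prod.ext (funext fun t => ?_) ?_
      · rw [Prod.fst_add, Prod.fst_sum, Pi.add_apply, Finset.sum_apply]
        simp only [he1, hy1 N]
        by_cases ht : t ∈ nodes p.1 p.2 N
        · have := hlt _ _ _ t ht
          rw [Finset.sum_eq_single t (fun _ _ h => if_neg h) (fun h => absurd ht h), if_pos rfl,
            if_neg (by omega), add_zero]
        · rw [Finset.sum_eq_zero fun s hs => if_neg (fun h : s = t => ht (h ▸ hs)), zero_add, hy1]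
          by_cases h : branchNode η t.1 = t
          · have hNt : N ≤ t.1 := by
              by_contra hlt'
              exact ht (Finset.mem_union_right _ (Finset.mem_biUnion.2
                ⟨η, hη, Finset.mem_image.2 ⟨t.1, Finset.mem_range.2 (by omega), h⟩⟩))
            rw [if_pos ⟨hNt, h⟩, if_pos ⟨hnN.trans hNt, h⟩]
            exact LinearMap.congr_fun (hcomp n N t.1 hnN hNt) x
          · rw [if_neg fun h' => h h'.2, if_neg fun h' => h h'.2]
      · rw [Prod.snd_add, Prod.snd_sum]
        simp only [he2, hy2, Finset.sum_const_zero, zero_add]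
        congr 1
        exact LinearMap.congr_fun (hπU n N) x
    let Fix : Submodule S P :=
      { carrier := {z | ∀ᶠ p : Finset T × Finset (ℕ → A) in Filter.atTop,
          ∀ᶠ N in Filter.atTop, θ p.1 p.2 N z = z}
        zero_mem' := by simp
        add_mem' := fun {a b} ha hb => by
          filter_upwards [ha, hb] with p hpa hpb
          filter_upwards [hpa, hpb] with N hNa hNb
          rw [map_add, hNa, hNb]
        smul_mem' := fun r a ha => by
          filter_upwards [ha] with p hpa
          filter_upwards [hpa] with N hNa
          rw [map_smul, hNa] }
    have hLFix : L ≤ Fix := by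
      refine sup_le (iSup_le ?_) (iSup_le ?_)
      · rintro s _ ⟨x, rfl⟩
        exact hfix_e s x
      · rintro ⟨n, η⟩ _ ⟨x, rfl⟩
        exact hfix_y n η x
    intro C
    have hC : ∀ᶠ p : Finset T × Finset (ℕ → A) in Filter.atTop,
        ∀ᶠ N in Filter.atTop, ∀ z ∈ C, θ p.1 p.2 N z = z := by
      simp only [Filter.eventually_all_finset]
      exact fun z _ => hLFix z.2
    obtain ⟨p, hp⟩ := hC.exists
    obtain ⟨N, hN⟩ := hp.exists
    let G := (nodes p.1 p.2 N → (ℕ →₀ S)) × (p.2 → (ℕ →₀ S))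
    let α : L →ₗ[S] G := LinearMap.prod
      (LinearMap.pi fun s => LinearMap.proj s.1 ∘ₗ LinearMap.fst S _ _ ∘ₗ L.subtype)
      (LinearMap.pi fun η => LinearMap.proj (branchNode η.1 N) ∘ₗ LinearMap.fst S _ _ ∘ₗ L.subtype)
    let β : G →ₗ[S] L := LinearMap.coprod
      (∑ s, E s.1 ∘ₗ LinearMap.proj s) (∑ η, Y N η.1 ∘ₗ LinearMap.proj η)
    have hβα : ∀ z ∈ C, β (α z) = z := by
      intro z hz
      apply Subtype.ext
      rw [← hN z hz, hθ, ← Finset.sum_coe_sort (nodes p.1 p.2 N), ← Finset.sum_coe_sort p.2]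
      change (((∑ s, E s.1 ∘ₗ LinearMap.proj s) (α z).1 +
        (∑ η, Y N η.1 ∘ₗ LinearMap.proj η) (α z).2 : L) : P) = _
      rw [LinearMap.sum_apply, LinearMap.sum_apply, Submodule.coe_add,
        AddSubmonoidClass.coe_finsetSum, AddSubmonoidClass.coe_finsetSum]
      rfl
    obtain ⟨ι, α', β', h'⟩ := IsLocallyProjective.of_projective (S := S) G (C.image α)
    exact ⟨ι, α' ∘ₗ α, β ∘ₗ β', fun z hz => by
      simp [h' (α z) (Finset.mem_image_of_mem _ hz), hβα z hz]⟩
  · intro η x hx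
    obtain ⟨m₀, hm₀⟩ := hker 0 x hx
    have : Y 0 η x = ∑ m ∈ Finset.range m₀, E (branchNode η m) (U 0 m x) := by
      apply Subtype.ext
      rw [AddSubmonoidClass.coe_finsetSum]
      change y 0 η x = ∑ m ∈ Finset.range m₀, e (branchNode η m) (U 0 m x)
      refine Prod.ext (funext fun t => ?_) ?_
      · rw [Prod.fst_sum, Finset.sum_apply, hy1]
        simp only [he1]
        by_cases h : branchNode η t.1 = t
        · rw [if_pos ⟨Nat.zero_le _, h⟩, Finset.sum_eq_single t.1, if_pos h]
          · intro m _ hm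
            exact if_neg fun h' => hm (congrArg Sigma.fst h')
          · intro ht
            rw [if_pos h]
            exact hm₀ _ (by simpa using ht)
        · rw [if_neg fun h' => h h'.2, Finset.sum_eq_zero]
          intro m _
          refine if_neg fun h' => h ?_
          rw [← h']
          rfl
      · rw [Prod.snd_sum, hy2, hx]
        simp [he2]
    rw [this]
    exact Submodule.sum_mem _ fun m _ => Submodule.mem_iSup_of_mem _ ⟨_, rfl⟩

end TreeModule

section Splitting

/-- Every type embeds in an infinite type `A` that has at least as many
sequences as subsets. -/
theorem exists_type_tower (X : Type u) :
    ∃ A : Type u, Infinite A ∧ Nonempty (X ↪ A) ∧ Nonempty (Set A ↪ (ℕ → A)) := by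
  let T : ℕ → Type u := fun n => Nat.rec (X ⊕ ULift.{u} ℕ) (fun _ Y => Set Y) n
  refine ⟨Σ n, T n, ?_, ⟨⟨fun x => ⟨0, (Sum.inl x : X ⊕ ULift.{u} ℕ)⟩, ?_⟩⟩,
    ⟨⟨fun s n => ⟨n + 1, ({a | (⟨n, a⟩ : Σ n, T n) ∈ s} : Set (T n))⟩, ?_⟩⟩⟩
  · refine Infinite.of_injective (fun n : ℕ => (⟨0, (Sum.inr ⟨n⟩ : X ⊕ ULift.{u} ℕ)⟩ : Σ n, T n)) ?_
    intro a b h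
    have := eq_of_heq (Sigma.mk.inj h).2
    exact congrArg ULift.down (Sum.inr_injective this)
  · intro a b h
    have := eq_of_heq (Sigma.mk.inj h).2
    exact Sum.inl_injective this
  · intro s t h
    ext ⟨n, a⟩
    have := eq_of_heq (Sigma.mk.inj (congrFun h n)).2
    exact Set.ext_iff.1 this a

/-- If `X` embeds in `A`, then there are more sets of sequences in `A` than functions from the
finite sequences in `A` to `X`. -/
theorem not_injective_of_tower {A X : Type u} [Infinite A] (hX : Nonempty (X ↪ A))
    (hA : Nonempty (Set A ↪ (ℕ → A))) (g : Set (ℕ → A) → ((Σ n, (Fin n → A)) × ℕ → X)) :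
    ¬ Function.Injective g := by
  intro hg
  have h1 : Cardinal.mk (Set (ℕ → A)) ≤ Cardinal.mk ((Σ n, (Fin n → A)) × ℕ → X) :=
    Cardinal.mk_le_of_injective hg
  have hle := (Cardinal.le_def _ _).2 hX
  have hA' := (Cardinal.le_def _ _).2 hA
  have hinf := Cardinal.aleph0_le_mk A
  have h2 : Cardinal.mk ((Σ n, (Fin n → A)) × ℕ) = Cardinal.mk A := by
    have : Cardinal.mk (Σ n, (Fin n → A)) = Cardinal.mk A := by
      rw [← Cardinal.mk_list_eq_mk A]
      exact Cardinal.mk_congr (Equiv.ofBijective (fun s : Σ n, (Fin n → A) => List.ofFn s.2)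
        (by
          constructor
          · rintro ⟨n, f⟩ ⟨m, g⟩ h
            exact List.ofFn_inj'.1 h
          · intro l
            exact ⟨⟨l.length, l.get⟩, List.ofFn_get l⟩))
    rw [Cardinal.mk_prod, Cardinal.lift_id', this]
    simp [Cardinal.mul_aleph0_eq hinf]
  rw [Cardinal.mk_set] at h1 hA'
  rw [← Cardinal.power_def, h2] at h1
  have h3 := h1.trans ((Cardinal.power_le_power_right hle).trans (Cardinal.power_self_eq hinf).le)
  exact absurd (h3.trans hA') (Cardinal.cantor _).not_ge

variable {S : Type u} [Ring S]

/-- A countable flat module is a direct summand of every module which maps to it with the lifting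
property for locally projective modules. -/
theorem IsEquationallyFlat.exists_section {B : Type u} [AddCommGroup B] [Module S B]
    [Countable S] (hB : IsEquationallyFlat S B) {π : (ℕ →₀ S) →ₗ[S] B}
    (hπ : Function.Surjective π) {X : Type u} [AddCommGroup X] [Module S X] (f : X →ₗ[S] B)
    (hf : ∀ (L : Type u) [AddCommGroup L] [Module S L], IsLocallyProjective S L →
      ∀ h : L →ₗ[S] B, ∃ g : L →ₗ[S] X, f ∘ₗ g = h) :
    ∃ σ : B →ₗ[S] X, f ∘ₗ σ = LinearMap.id := by
  classical
  obtain ⟨U, -, hcomp, hπU, hker⟩ := hB.exists_sequence hπ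
  obtain ⟨A, hA, hXA, hAA⟩ := exists_type_tower X
  obtain ⟨L, _, _, E, Y, b, hL, hbE, hbY, hYE⟩ := exists_treeModule hcomp hπU hker A
  let c : Set (ℕ → A) → ((ℕ → A) →₀ B) →ₗ[S] B := fun Z =>
    Finsupp.lsum ℕ fun η => if η ∈ Z then LinearMap.id else 0
  have hc : ∀ Z η y, c Z (Finsupp.single η y) = if η ∈ Z then y else 0 := by
    intro Z η y
    simp only [c, Finsupp.lsum_single]
    split_ifs <;> rfl
  choose g hg using fun Z => hf L hL (c Z ∘ₗ b)
  have aux : ∀ Z Z', (∀ s, g Z ∘ₗ E s = g Z' ∘ₗ E s) → ∀ η, η ∈ Z → η ∉ Z' →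
      ∃ σ : B →ₗ[S] X, f ∘ₗ σ = LinearMap.id := by
    intro Z Z' hZ η hη hη'
    have hle : (⨆ s, LinearMap.range (E s)) ≤ LinearMap.ker (g Z - g Z') := by
      refine iSup_le ?_
      rintro s _ ⟨x, rfl⟩
      rw [LinearMap.mem_ker, LinearMap.sub_apply, sub_eq_zero]
      exact LinearMap.congr_fun (hZ s) x
    obtain ⟨σ, hσ⟩ := LinearMap.exists_comp_eq_of_ker_le hπ ((g Z - g Z') ∘ₗ Y η)
      fun k hk => hle (hYE η k hk)
    refine ⟨σ, ?_⟩
    ext y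
    obtain ⟨x, rfl⟩ := hπ y
    have h1 := LinearMap.congr_fun hσ x
    have h2 := LinearMap.congr_fun (hg Z) (Y η x)
    have h3 := LinearMap.congr_fun (hg Z') (Y η x)
    simp only [LinearMap.comp_apply, LinearMap.sub_apply, hbY, hc, if_pos hη, if_neg hη'] at h1 h2 h3
    rw [LinearMap.comp_apply, h1, map_sub, h2, h3, sub_zero, LinearMap.id_apply]
  have hni := not_injective_of_tower hXA hAA
    fun Z (p : (Σ n, (Fin n → A)) × ℕ) => g Z (E p.1 (Finsupp.single p.2 1))
  obtain ⟨Z, Z', hZZ, hne⟩ : ∃ Z Z', (∀ s, g Z ∘ₗ E s = g Z' ∘ₗ E s) ∧ Z ≠ Z' := by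
    simp only [Function.Injective, not_forall] at hni
    obtain ⟨Z, Z', h, hne⟩ := hni
    refine ⟨Z, Z', fun s => ?_, hne⟩
    ext i
    exact congrFun h (s, i)
  obtain ⟨η, hη, hη'⟩ | ⟨η, hη, hη'⟩ : (∃ η, η ∈ Z ∧ η ∉ Z') ∨ ∃ η, η ∈ Z' ∧ η ∉ Z := by
    by_contra! h
    exact hne (Set.Subset.antisymm h.1 h.2)
  · exact aux Z Z' hZZ η hη hη'
  · exact aux Z' Z (fun s => (hZZ s).symm) η hη hη'

end Splitting

section CountableReduction

variable {S : Type u} [Ring S]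

theorem IsEquationallyFlat.projective_of_lifting {B : Type u} [AddCommGroup B] [Module S B]
    [Countable S] [Countable B] (hB : IsEquationallyFlat S B) {X : Type u} [AddCommGroup X]
    [Module S X] (hX : HasMinimalLifts S X) (f : X →ₗ[S] B)
    (hf : ∀ (L : Type u) [AddCommGroup L] [Module S L], IsLocallyProjective S L →
      ∀ h : L →ₗ[S] B, ∃ g : L →ₗ[S] X, f ∘ₗ g = h) :
    Module.Projective S B := by
  obtain ⟨b, hb⟩ := exists_surjective_nat B
  have hπ : Function.Surjective (Finsupp.linearCombination S b) := fun x => by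
    obtain ⟨i, rfl⟩ := hb x
    exact ⟨Finsupp.single i 1, by simp⟩
  obtain ⟨σ, hσ⟩ := hB.exists_section hπ f hf
  exact hB.projective_of_minimalLifts hπ fun _ x => hX.exists_of_retract hσ hπ x

theorem isEquationallyFlat_quotient_iff {ι : Type*} {M : Type u} [AddCommGroup M] [Module S M]
    {π : (ι →₀ S) →ₗ[S] M} (hπ : Function.Surjective π) (U : Submodule S M) :
    IsEquationallyFlat S (M ⧸ U) ↔ ∀ k, π k ∈ U → ∃ φ : (ι →₀ S) →ₗ[S] (ι →₀ S),
      (∀ x, π (φ x) - π x ∈ U) ∧ φ k = 0 := by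
  classical
  have hq : Function.Surjective (U.mkQ ∘ₗ π) := (Submodule.mkQ_surjective U).comp hπ
  have hp := Finsupp.linearCombination_id_surjective S (M ⧸ U)
  constructor
  · intro h k hk
    obtain ⟨φ, hφ, hφk⟩ := h.exists_end (U.mkQ ∘ₗ π) hq {k}
    refine ⟨φ, fun x => ?_, hφk k (Finset.mem_singleton_self k) ?_⟩
    · exact (Submodule.Quotient.eq U).1 (LinearMap.congr_fun hφ x)
    · exact (Submodule.Quotient.mk_eq_zero U).2 hk
  · intro h k hk
    obtain ⟨μ, hμ⟩ := Module.projective_lifting_property (U.mkQ ∘ₗ π)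
      (Finsupp.linearCombination S (id : M ⧸ U → M ⧸ U)) hq
    obtain ⟨l, hl⟩ := Module.projective_lifting_property
      (Finsupp.linearCombination S (id : M ⧸ U → M ⧸ U)) (U.mkQ ∘ₗ π) hp
    obtain ⟨φ, hφ, hφk⟩ := h (μ k) ((Submodule.Quotient.mk_eq_zero U).1
      ((LinearMap.congr_fun hμ k).trans hk))
    refine ⟨l ∘ₗ φ ∘ₗ μ, ?_, by simp [hφk]⟩
    have : (U.mkQ ∘ₗ π) ∘ₗ φ = U.mkQ ∘ₗ π :=
      LinearMap.ext fun x => (Submodule.Quotient.eq U).2 (hφ x)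
    rw [← LinearMap.comp_assoc, hl, ← LinearMap.comp_assoc, this, hμ]

theorem Submodule.countable_span [Countable S] {M : Type*} [AddCommGroup M] [Module S M]
    {C : Set M} (hC : C.Countable) : (Submodule.span S C : Set M).Countable := by
  have := hC.to_subtype
  rw [Finsupp.span_eq_range_linearCombination, LinearMap.coe_range]
  exact Set.countable_range _

/-- Every element of a flat module over a countable ring is contained in a countable pure
submodule. -/
theorem IsEquationallyFlat.exists_countable_submodule [Countable S] {N : Type u} [AddCommGroup N]
    [Module S N] (hN : IsEquationallyFlat S N) (n : N) :
    ∃ V : Submodule S N, n ∈ V ∧ Countable V ∧ IsEquationallyFlat S V ∧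
      IsEquationallyFlat S (N ⧸ V) := by
  classical
  let p : (N →₀ S) →ₗ[S] N := Finsupp.linearCombination S id
  have hφ : ∀ k : N →₀ S, ∃ φ : (N →₀ S) →ₗ[S] (N →₀ S), p ∘ₗ φ = p ∧ (p k = 0 → φ k = 0) := by
    intro k
    by_cases hk : p k = 0
    · obtain ⟨φ, h1, h2⟩ := hN k hk
      exact ⟨φ, h1, fun _ => h2⟩
    · exact ⟨LinearMap.id, rfl, fun h => absurd h hk⟩
  choose φ hpφ hφk using hφ
  have hw : ∀ (c : ℕ →₀ S) (v : N), ∃ w : ℕ → N, (∃ w', Finsupp.linearCombination S w' c = v) →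
      Finsupp.linearCombination S w c = v := by
    intro c v
    by_cases h : ∃ w' : ℕ → N, Finsupp.linearCombination S w' c = v
    · obtain ⟨w, hw⟩ := h
      exact ⟨w, fun _ => hw⟩
    · exact ⟨0, fun h' => absurd h' h⟩
  choose w hw using hw
  have step : ∀ W : Submodule S N, (W : Set N).Countable → ∃ W' : Submodule S N,
      (W' : Set N).Countable ∧ W ≤ W' ∧
      (∀ k : N →₀ S, (∀ j ∈ k.support, j ∈ W) → ∀ j ∈ W, ∀ i ∈ (φ k (Finsupp.single j 1)).support,
        i ∈ W') ∧ ∀ (c : ℕ →₀ S), ∀ v ∈ W, ∀ i, w c v i ∈ W' := by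
    intro W hW
    have : Countable W := hW.to_subtype
    let k' : (W →₀ S) → (N →₀ S) := Finsupp.mapDomain Subtype.val
    refine ⟨Submodule.span S (W ∪ ((⋃ q : (W →₀ S) × W,
      ((φ (k' q.1) (Finsupp.single q.2.1 1)).support : Set N)) ∪
        ⋃ q : (ℕ →₀ S) × W × ℕ, {w q.1 q.2.1 q.2.2})), ?_, ?_, ?_, ?_⟩
    · refine Submodule.countable_span (hW.union (Set.Countable.union ?_ ?_))
      · exact Set.countable_iUnion fun q => Finset.countable_toSet _
      · exact Set.countable_iUnion fun q => Set.countable_singleton _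
    · exact fun x hx => Submodule.subset_span (Or.inl hx)
    · intro k hk j hj i hi
      refine Submodule.subset_span (Or.inr (Or.inl (Set.mem_iUnion.2
        ⟨(k.comapDomain Subtype.val Subtype.val_injective.injOn, ⟨j, hj⟩), ?_⟩)))
      have : k' (k.comapDomain Subtype.val Subtype.val_injective.injOn) = k :=
        Finsupp.mapDomain_comapDomain _ Subtype.val_injective _ fun x hx =>
          ⟨⟨x, hk x hx⟩, rfl⟩
      simpa only [this, Finset.mem_coe] using hi
    · intro c v hv i
      exact Submodule.subset_span (Or.inr (Or.inr (Set.mem_iUnion.2 ⟨(c, ⟨v, hv⟩, i), rfl⟩)))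
  choose! G hGc hGle hGφ hGw using step
  let W : ℕ → Submodule S N := fun i => G^[i] (Submodule.span S {n})
  have hWsucc : ∀ i, W (i + 1) = G (W i) := fun i => Function.iterate_succ_apply' _ _ _
  have hWc : ∀ i, (W i : Set N).Countable := by
    intro i
    induction i with
    | zero => exact Submodule.countable_span (Set.countable_singleton n)
    | succ i ih => rw [hWsucc]; exact hGc _ ih
  have hmono : Monotone W := monotone_nat_of_le_succ fun i => by
    rw [hWsucc]; exact hGle _ (hWc i)
  let V : Submodule S N := ⨆ i, W i
  have hV : ∀ x, x ∈ V ↔ ∃ i, x ∈ W i := fun x =>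
    Submodule.mem_iSup_of_directed _ hmono.directed_le
  have hVφ : ∀ k : N →₀ S, (∀ j ∈ k.support, j ∈ V) → ∀ j ∈ V,
      ∀ i ∈ (φ k (Finsupp.single j 1)).support, i ∈ V := by
    intro k hk j hj i hi
    have h1 : ∃ m, ∀ j ∈ k.support, j ∈ W m := by
      have : ∀ᶠ m in Filter.atTop, ∀ j ∈ k.support, j ∈ W m := by
        rw [Filter.eventually_all_finset]
        intro j hj
        obtain ⟨m, hm⟩ := (hV j).1 (hk j hj)
        filter_upwards [Filter.eventually_ge_atTop m] with m' hm'
        exact hmono hm' hm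
      exact this.exists
    obtain ⟨m, hm⟩ := h1
    obtain ⟨m', hm'⟩ := (hV j).1 hj
    refine (hV i).2 ⟨max m m' + 1, ?_⟩
    rw [hWsucc]
    exact hGφ _ (hWc _) k (fun j hj => hmono (le_max_left _ _) (hm j hj)) j
      (hmono (le_max_right _ _) hm') i hi
  have hVw : ∀ a : N →₀ S, p a ∈ V → ∃ u : N → N, (∀ j, u j ∈ V) ∧
      Finsupp.linearCombination S u a = p a := by
    intro a ha
    obtain ⟨e, he⟩ : ∃ e : N → ℕ, Set.InjOn e a.support :=
      Set.countable_iff_exists_injOn.1 (Finset.countable_toSet a.support)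
    let c := a.mapDomain e
    have hc : ∀ w' : ℕ → N,
        Finsupp.linearCombination S w' c = Finsupp.linearCombination S (w' ∘ e) a :=
      fun w' => Finsupp.linearCombination_mapDomain S _ _
    obtain ⟨m, hm⟩ := (hV _).1 ha
    refine ⟨w c (p a) ∘ e, fun j => (hV _).2 ⟨m + 1, ?_⟩, ?_⟩
    · rw [hWsucc]
      exact hGw _ (hWc m) c _ hm _
    · rw [← hc]
      refine hw c (p a) ⟨Function.invFunOn e a.support, ?_⟩
      rw [hc]
      simp only [p, Finsupp.linearCombination_apply]
      refine Finsupp.sum_congr fun j hj => ?_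
      rw [Function.comp_apply, he.leftInvOn_invFunOn hj, id]
  refine ⟨V, (hV n).2 ⟨0, Submodule.mem_span_singleton_self n⟩, ?_, ?_, ?_⟩
  · have : (V : Set N) = ⋃ i, (W i : Set N) := by
      ext x
      simp [hV]
    refine Set.Countable.to_subtype (s := (V : Set N)) ?_
    rw [this]
    exact Set.countable_iUnion hWc
  · intro k hk
    let j : (V →₀ S) →ₗ[S] (N →₀ S) := Finsupp.lmapDomain S S Subtype.val
    have hj : Function.Injective j := Finsupp.mapDomain_injective Subtype.val_injective
    have hpj : ∀ x, p (j x) = (Finsupp.linearCombination S (id : V → V) x : V) := by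
      intro x
      induction x using Finsupp.induction_linear with
      | zero => simp
      | add x y hx hy => simp [hx, hy]
      | single i r => simp [j, p]
    have hjk : ∀ i ∈ (j k).support, i ∈ V := by
      intro i hi
      obtain ⟨x, _, rfl⟩ := Finset.mem_image.1 (Finsupp.mapDomain_support hi)
      exact x.2
    let ψ : (V →₀ S) →ₗ[S] (V →₀ S) := Finsupp.linearCombination S fun i : V =>
      (φ (j k) (Finsupp.single i.1 1)).comapDomain Subtype.val Subtype.val_injective.injOn
    have hψ : ∀ x, j (ψ x) = φ (j k) (j x) := by
      intro x
      induction x using Finsupp.induction_linear with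
      | zero => simp
      | add x y hx hy => simp [hx, hy]
      | single i r =>
        have h1 : j (ψ (Finsupp.single i 1)) = φ (j k) (j (Finsupp.single i 1)) := by
          simp only [ψ, Finsupp.linearCombination_single, one_smul]
          simp only [j, Finsupp.lmapDomain_apply, Finsupp.mapDomain_single]
          exact Finsupp.mapDomain_comapDomain _ Subtype.val_injective _ fun x hx =>
            ⟨⟨x, hVφ _ hjk i i.2 x hx⟩, rfl⟩
        have h2 : Finsupp.single i r = r • Finsupp.single i (1 : S) := by simp
        rw [h2, map_smul, map_smul, map_smul, map_smul, h1]
    refine ⟨ψ, LinearMap.ext fun x => Subtype.ext ?_, hj ?_⟩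
    · rw [LinearMap.comp_apply, ← hpj, ← hpj, hψ]
      exact LinearMap.congr_fun (hpφ _) _
    · rw [hψ, map_zero]
      refine hφk _ ?_
      rw [hpj, hk, Submodule.coe_zero]
  · rw [isEquationallyFlat_quotient_iff (Finsupp.linearCombination_id_surjective S N)]
    intro a ha
    obtain ⟨u, huV, hu⟩ := hVw a ha
    let τ : (N →₀ S) →ₗ[S] (N →₀ S) := LinearMap.id - Finsupp.lmapDomain S S u
    have hτ : ∀ x, p (τ x) = p x - Finsupp.linearCombination S u x := by
      intro x
      simp [τ, p, Finsupp.linearCombination_mapDomain]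
    refine ⟨φ (τ a) ∘ₗ τ, fun x => ?_, hφk _ ?_⟩
    · have h1 : p (φ (τ a) (τ x)) = p (τ x) := LinearMap.congr_fun (hpφ _) _
      change p (φ (τ a) (τ x)) - p x ∈ V
      rw [h1, hτ, sub_sub_cancel_left, neg_mem_iff, Finsupp.linearCombination_apply]
      exact Submodule.sum_mem _ fun j _ => V.smul_mem _ (huV j)
    · rw [hτ, hu, sub_self]

/-- If the countable flat modules over a countable ring are projective, then all flat modules
are. -/
theorem IsEquationallyFlat.projective_of_countable [Countable S]
    (H : ∀ (V : Type u) [AddCommGroup V] [Module S V] [Countable V], IsEquationallyFlat S V →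
      Module.Projective S V) {N : Type u} [AddCommGroup N] [Module S N]
    (hN : IsEquationallyFlat S N) : Module.Projective S N := by
  classical
  let p : (N →₀ S) →ₗ[S] N := Finsupp.linearCombination S id
  have hp : Function.Surjective p := Finsupp.linearCombination_id_surjective S N
  obtain ⟨K, hK⟩ := zorn_le₀ {K : Submodule S (N →₀ S) | (∀ x ∈ K, p x = 0 → x = 0) ∧
      IsEquationallyFlat S (N ⧸ K.map p)} (by
    intro c hc hchain
    rcases c.eq_empty_or_nonempty with rfl | hne
    · refine ⟨⊥, ⟨fun x hx _ => (Submodule.mem_bot S).1 hx, ?_⟩, by simp⟩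
      rw [isEquationallyFlat_quotient_iff hp]
      intro k hk
      rw [Submodule.map_bot, Submodule.mem_bot] at hk
      obtain ⟨φ, hφ, hφk⟩ := hN k hk
      refine ⟨φ, fun x => ?_, hφk⟩
      rw [← LinearMap.comp_apply, hφ, sub_self]
      exact zero_mem _
    · have hmem : ∀ x, x ∈ sSup c ↔ ∃ K ∈ c, x ∈ K := fun x =>
        Submodule.mem_sSup_of_directed hne hchain.directedOn
      refine ⟨sSup c, ⟨fun x hx hx0 => ?_, ?_⟩, fun K hK => le_sSup hK⟩
      · obtain ⟨K, hK, hx⟩ := (hmem x).1 hx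
        exact (hc hK).1 x hx hx0
      · rw [isEquationallyFlat_quotient_iff hp]
        rintro k ⟨x, hx, hxk⟩
        obtain ⟨K, hK, hx⟩ := (hmem x).1 hx
        obtain ⟨φ, hφ, hφk⟩ := (isEquationallyFlat_quotient_iff hp _).1 (hc hK).2 k ⟨x, hx, hxk⟩
        exact ⟨φ, fun y => Submodule.map_mono (le_sSup hK) (hφ y), hφk⟩)
  obtain ⟨⟨hK0, hKflat⟩, hKmax⟩ := hK
  have htop : K.map p = ⊤ := by
    rw [eq_top_iff]
    intro n _
    by_contra hn
    obtain ⟨V, hnV, hVc, hVflat, hVquot⟩ :=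
      hKflat.exists_countable_submodule ((K.map p).mkQ n)
    have hπ : Function.Surjective ((K.map p).mkQ ∘ₗ p) :=
      (Submodule.mkQ_surjective _).comp hp
    have := H V hVflat
    obtain ⟨t, ht⟩ := Module.projective_lifting_property ((K.map p).mkQ ∘ₗ p) V.subtype hπ
    have ht' : ∀ v, (K.map p).mkQ (p (t v)) = v := fun v => LinearMap.congr_fun ht v
    have hKq : ∀ x ∈ K, (K.map p).mkQ (p x) = 0 := fun x hx =>
      (Submodule.Quotient.mk_eq_zero _).2 (Submodule.mem_map_of_mem hx)
    have hmap : (K ⊔ LinearMap.range t).map p = V.comap (K.map p).mkQ := by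
      refine le_antisymm ?_ ?_
      · rw [Submodule.map_le_iff_le_comap]
        refine sup_le (fun x hx => ?_) ?_
        · change (K.map p).mkQ (p x) ∈ V
          rw [hKq x hx]
          exact zero_mem _
        · rintro _ ⟨v, rfl⟩
          change (K.map p).mkQ (p (t v)) ∈ V
          rw [ht']
          exact v.2
      · intro x hx
        let v : V := ⟨_, hx⟩
        have h1 : x - p (t v) ∈ K.map p := (Submodule.Quotient.eq _).1 (ht' v).symm
        rw [Submodule.map_sup]
        have h2 := Submodule.add_mem_sup h1
          (Submodule.mem_map_of_mem (f := p) (LinearMap.mem_range_self t v))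
        rwa [sub_add_cancel] at h2
    have hle := hKmax (y := K ⊔ LinearMap.range t) ⟨?_, ?_⟩ le_sup_left
    · have h1 : t ⟨_, hnV⟩ ∈ K := hle (Submodule.mem_sup_right (LinearMap.mem_range_self t _))
      have h2 := hKq _ h1
      rw [ht'] at h2
      exact hn ((Submodule.Quotient.mk_eq_zero _).1 h2)
    · intro x hx hx0
      obtain ⟨k, hk, _, ⟨v, rfl⟩, rfl⟩ := Submodule.mem_sup.1 hx
      have h1 : v = 0 := by
        apply Subtype.ext
        rw [← ht', Submodule.coe_zero]
        have := congrArg (K.map p).mkQ hx0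
        rwa [map_add, map_add, hKq k hk, zero_add, map_zero] at this
      rw [h1, map_zero, add_zero] at hx0 ⊢
      exact hK0 k hk hx0
    · rw [isEquationallyFlat_quotient_iff hp, hmap]
      exact (isEquationallyFlat_quotient_iff hπ V).1 hVquot
  have hbij : Function.Bijective (p ∘ₗ K.subtype) := by
    constructor
    · rw [injective_iff_map_eq_zero]
      exact fun x hx => Subtype.ext (hK0 x x.2 hx)
    · intro n
      obtain ⟨x, hx, hxn⟩ : n ∈ K.map p := htop ▸ Submodule.mem_top
      exact ⟨⟨x, hx⟩, hxn⟩
  refine Module.Projective.of_split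
    (K.subtype ∘ₗ (LinearEquiv.ofBijective _ hbij).symm.toLinearMap) p ?_
  ext n
  exact LinearEquiv.apply_symm_apply (LinearEquiv.ofBijective _ hbij) n

end CountableReduction

open CategoryTheory in
/-- For a countable ring `R`, the class `𝒟` of flat Mittag-Leffler
right `R`-modules is precovering iff `R` is right perfect (equivalently, every flat
right `R`-module is projective). -/
theorem flat_mittagLeffler_precovering_iff_rightPerfect
    (R : Type u) [Ring R] [Countable R] :
    (∀ M : ModuleCat.{u} Rᵐᵒᵖ, ∃ (X : ModuleCat.{u} Rᵐᵒᵖ) (f : X ⟶ M),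
        (IsRightFlat R X ∧ IsMittagLeffler R X) ∧
        ∀ X' : ModuleCat.{u} Rᵐᵒᵖ, IsRightFlat R X' → IsMittagLeffler R X' →
          ∀ f' : X' ⟶ M, ∃ g : X' ⟶ X, f' = g ≫ f) ↔
      (∀ (N : Type u) [AddCommGroup N] [Module Rᵐᵒᵖ N],
        IsRightFlat R N → Module.Projective Rᵐᵒᵖ N) := by
  constructor
  · intro h N _ _ hN
    have : Countable Rᵐᵒᵖ := MulOpposite.unop_injective.countable
    refine hN.isEquationallyFlat.projective_of_countable fun V _ _ _ hV => ?_
    obtain ⟨X, f, ⟨hX, hX'⟩, hlift⟩ := h (ModuleCat.of Rᵐᵒᵖ V)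
    refine hV.projective_of_lifting (hX'.hasMinimalLifts hX) f.hom fun L _ _ hL g => ?_
    obtain ⟨g', hg'⟩ := hlift (ModuleCat.of Rᵐᵒᵖ L) hL.isRightFlat hL.isMittagLeffler
      (ModuleCat.ofHom g)
    exact ⟨g'.hom, (congrArg ModuleCat.Hom.hom hg').symm⟩
  · intro h M
    have hX := IsLocallyProjective.of_projective (S := Rᵐᵒᵖ) (M →₀ Rᵐᵒᵖ)
    refine ⟨ModuleCat.of Rᵐᵒᵖ (M →₀ Rᵐᵒᵖ),
      ModuleCat.ofHom (Finsupp.linearCombination Rᵐᵒᵖ (id : M → M)),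
      ⟨hX.isRightFlat, hX.isMittagLeffler⟩, fun X' hX' _ f' => ?_⟩
    have := h X' hX'
    obtain ⟨g, hg⟩ := Module.projective_lifting_property
      (Finsupp.linearCombination Rᵐᵒᵖ (id : M → M)) f'.hom
      (Finsupp.linearCombination_id_surjective Rᵐᵒᵖ M)
    exact ⟨ModuleCat.ofHom g, ModuleCat.hom_ext hg.symm⟩
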